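/- For every associative, not necessarily unital, ℂ-algebra A and every n ≥ 0, the following identities hold on Ωⁿ A: (1) κⁿ = id + b ∘ κⁿ ∘ d; (2) κ^{n+1}(dω) = dω for all ω ∈ Ωⁿ A; (3) κ^{n+1} = id − d ∘ b; (4) κⁿ(b ω) = b ω for all ω ∈ Ωⁿ A (n ≥ 1); (5) (κⁿ − id) ∘ (κ^{n+1} − id) = 0 on Ωⁿ A. In particular the Karoubi operator satisfies a polynomial identity on each Ωⁿ A. -/

import Mathlib

open scoped TensorProduct

/-- The differential graded algebra `Ω A` of noncommutative differential forms over the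
(not necessarily unital) `ℂ`-algebra `A`, presented through its canonical structure:
a (non-unital) `ℂ`-algebra graded by subspaces `deg n` (with `deg n` corresponding to
`Ωⁿ A = Ã ⊗ A^{⊗n}`), `Ω⁰ A = A` embedded via the injective algebra map `ι`, the
differential `d` with `d ∘ d = 0` and the graded Leibniz rule, the defining recursion
`(d a)·y = d (a·y) − a·(d y)` for `a, y ∈ A`, and every `Ω^{n+1} A` spanned by the
elementary forms `ã₀ da₁ ⋯ da_{n+1}`. -/
structure Forms (A : Type) [NonUnitalRing A] [Module ℂ A]
    [SMulCommClass ℂ A A] [IsScalarTower ℂ A A] : Type 1 where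
  Ω : Type
  [ringΩ : NonUnitalRing Ω]
  [modΩ : Module ℂ Ω]
  [smulCommΩ : SMulCommClass ℂ Ω Ω]
  [towerΩ : IsScalarTower ℂ Ω Ω]
  deg : ℕ → Submodule ℂ Ω
  internal : DirectSum.IsInternal deg
  mul_mem' : ∀ {m n : ℕ} {x y : Ω}, x ∈ deg m → y ∈ deg n → x * y ∈ deg (m + n)
  ι : A →ₗ[ℂ] Ω
  ι_injective : Function.Injective ι
  ι_mul : ∀ a b : A, ι (a * b) = ι a * ι b
  deg_zero : deg 0 = LinearMap.range ι
  d : Ω →ₗ[ℂ] Ω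
  d_mem : ∀ {n : ℕ} {x : Ω}, x ∈ deg n → d x ∈ deg (n + 1)
  d_d : ∀ x : Ω, d (d x) = 0
  leibniz : ∀ {n : ℕ} {x : Ω}, x ∈ deg n → ∀ y : Ω,
    d (x * y) = d x * y + ((-1 : ℂ) ^ n) • (x * d y)
  da_mul : ∀ a y : A, d (ι a) * ι y = d (ι (a * y)) - ι a * d (ι y)
  deg_one : deg 1 = Submodule.span ℂ
    ({x | ∃ a : A, x = d (ι a)} ∪ {x | ∃ a b : A, x = ι a * d (ι b)})
  deg_succ : ∀ n : ℕ, deg (n + 2) =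
    Submodule.span ℂ {x | ∃ ω ∈ deg (n + 1), ∃ a : A, x = ω * d (ι a)}

attribute [instance] Forms.ringΩ Forms.modΩ Forms.smulCommΩ Forms.towerΩ

namespace Forms

variable {A : Type} [NonUnitalRing A] [Module ℂ A] [SMulCommClass ℂ A A] [IsScalarTower ℂ A A]

/-- The word `d a₁ ⋯ d aₙ`, as an element of the unitization of `Ω A` (the empty word
being the adjoined unit). -/
noncomputable def wordU (F : Forms A) (l : List A) : Unitization ℂ F.Ω :=
  (l.map fun a => (Unitization.inr (F.d (F.ι a)) : Unitization ℂ F.Ω)).prod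

/-- The word `d a₁ d b₁ ⋯ d aₙ d bₙ` of even length, as an element of the unitization
of `Ω A`. -/
noncomputable def wordU2 (F : Forms A) (l : List (A × A)) : Unitization ℂ F.Ω :=
  (l.map fun q => (Unitization.inr (F.d (F.ι q.1) * F.d (F.ι q.2)) : Unitization ℂ F.Ω)).prod

/-- The even part `Ω^{even} A = ⊕ₙ Ω^{2n} A`; endowed with the Fedosov product
`x ⊙ y = x·y − dx·dy` it is the tensor algebra `T A`. -/
def evenPart (F : Forms A) : Submodule ℂ F.Ω := ⨆ n : ℕ, F.deg (2 * n)

end Forms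

namespace Forms

section

variable {A : Type} [NonUnitalRing A] [Module ℂ A] [SMulCommClass ℂ A A] [IsScalarTower ℂ A A]
  (F : Forms A)

/-- Right multiplication of a form by the word `d a₁ ⋯ d aₙ`. -/
def mulWord (ω : F.Ω) (l : List A) : F.Ω :=
  l.foldl (fun x a => x * F.d (F.ι a)) ω

/-- Left multiplication of a form by the word `d a₁ ⋯ d aₙ`. -/
def wordMul (l : List A) (ω : F.Ω) : F.Ω :=
  l.foldr (fun a x => F.d (F.ι a) * x) ω

theorem ι_mem (a : A) : F.ι a ∈ F.deg 0 := by
  rw [F.deg_zero]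
  exact ⟨a, rfl⟩

theorem d_ι_mem (a : A) : F.d (F.ι a) ∈ F.deg 1 :=
  F.d_mem (F.ι_mem a)

theorem mul_d_ι_mem {n : ℕ} {ω : F.Ω} (hω : ω ∈ F.deg n) (a : A) :
    ω * F.d (F.ι a) ∈ F.deg (n + 1) :=
  F.mul_mem' hω (F.d_ι_mem a)

theorem d_ι_mul_mem {n : ℕ} {ω : F.Ω} (hω : ω ∈ F.deg n) (a : A) :
    F.d (F.ι a) * ω ∈ F.deg (n + 1) := by
  rw [add_comm]
  exact F.mul_mem' (F.d_ι_mem a) hω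

theorem ι_mul_mem {n : ℕ} {ω : F.Ω} (hω : ω ∈ F.deg n) (a : A) : F.ι a * ω ∈ F.deg n := by
  simpa using F.mul_mem' (F.ι_mem a) hω

theorem mul_ι_mem {n : ℕ} {ω : F.Ω} (hω : ω ∈ F.deg n) (a : A) : ω * F.ι a ∈ F.deg n :=
  F.mul_mem' hω (F.ι_mem a)

theorem d_mul_d_ι {n : ℕ} {ω : F.Ω} (hω : ω ∈ F.deg n) (a : A) :
    F.d (ω * F.d (F.ι a)) = F.d ω * F.d (F.ι a) := by
  simp [F.leibniz hω, F.d_d]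

theorem mulWord_append_singleton (ω : F.Ω) (l : List A) (a : A) :
    F.mulWord ω (l ++ [a]) = F.mulWord ω l * F.d (F.ι a) := by
  simp [mulWord]

theorem wordMul_append_singleton (ω : F.Ω) (l : List A) (a : A) :
    F.wordMul (l ++ [a]) ω = F.wordMul l (F.d (F.ι a) * ω) := by
  simp [wordMul]

theorem mul_mulWord (x ω : F.Ω) (l : List A) : x * F.mulWord ω l = F.mulWord (x * ω) l := by
  induction l using List.reverseRecOn with
  | nil => rfl
  | append_singleton l a ih => simp only [mulWord_append_singleton, ← mul_assoc, ih]

theorem mulWord_mul_eq_wordMul (l : List A) (a : A) (ω : F.Ω) :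
    F.mulWord (F.d (F.ι a)) l * ω = F.wordMul (a :: l) ω := by
  induction l using List.reverseRecOn generalizing ω with
  | nil => rfl
  | append_singleton l c ih =>
    rw [mulWord_append_singleton, mul_assoc, ih, ← List.cons_append, wordMul_append_singleton]

theorem mulWord_mem {m : ℕ} {ω : F.Ω} (hω : ω ∈ F.deg m) (l : List A) :
    F.mulWord ω l ∈ F.deg (m + l.length) := by
  induction l using List.reverseRecOn with
  | nil => exact hω
  | append_singleton l a ih =>
    simpa [mulWord_append_singleton, ← add_assoc] using F.mul_d_ι_mem ih a

theorem d_mulWord {m : ℕ} {ω : F.Ω} (hω : ω ∈ F.deg m) (l : List A) :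
    F.d (F.mulWord ω l) = F.mulWord (F.d ω) l := by
  induction l using List.reverseRecOn with
  | nil => rfl
  | append_singleton l a ih =>
    rw [mulWord_append_singleton, F.d_mul_d_ι (F.mulWord_mem hω l), ih, mulWord_append_singleton]

theorem deg_succ_le_span (n : ℕ) :
    F.deg (n + 1) ≤ Submodule.span ℂ ({x | n = 0 ∧ ∃ a : A, x = F.d (F.ι a)} ∪
      {x | ∃ ω ∈ F.deg n, ∃ a : A, x = ω * F.d (F.ι a)}) := by
  cases n with
  | zero =>
    rw [zero_add, F.deg_one]
    refine Submodule.span_mono (Set.union_subset_union ?_ ?_)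
    · rintro x hx
      exact ⟨rfl, hx⟩
    · rintro x ⟨a, c, rfl⟩
      exact ⟨F.ι a, F.ι_mem a, c, rfl⟩
  | succ n =>
    rw [F.deg_succ]
    exact Submodule.span_mono Set.subset_union_right

/-- Linear maps agreeing on the forms `d a` (in degree one) and `ω d a` agree in positive degree. -/
theorem eqOn_deg_succ {n : ℕ} {f g : F.Ω →ₗ[ℂ] F.Ω}
    (h₁ : n = 0 → ∀ a : A, f (F.d (F.ι a)) = g (F.d (F.ι a)))
    (h₂ : ∀ ω ∈ F.deg n, ∀ a : A, f (ω * F.d (F.ι a)) = g (ω * F.d (F.ι a)))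
    {x : F.Ω} (hx : x ∈ F.deg (n + 1)) : f x = g x := by
  refine LinearMap.eqOn_span ?_ (F.deg_succ_le_span n hx)
  rintro x (⟨hn, a, rfl⟩ | ⟨ω, hω, a, rfl⟩)
  · exact h₁ hn a
  · exact h₂ ω hω a

/-- Linear maps agreeing on the elementary forms of degree `n` agree on `Ωⁿ A`. -/
theorem eqOn_deg_of_mulWord {n : ℕ} {f g : F.Ω →ₗ[ℂ] F.Ω}
    (h₁ : ∀ (a : A) (l : List A), l.length = n →
      f (F.mulWord (F.ι a) l) = g (F.mulWord (F.ι a) l))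
    (h₂ : ∀ (a : A) (l : List A), l.length + 1 = n →
      f (F.mulWord (F.d (F.ι a)) l) = g (F.mulWord (F.d (F.ι a)) l))
    {x : F.Ω} (hx : x ∈ F.deg n) : f x = g x := by
  induction n generalizing f g x with
  | zero =>
    rw [F.deg_zero] at hx
    obtain ⟨a, rfl⟩ := hx
    exact h₁ a [] rfl
  | succ n ih =>
    refine F.eqOn_deg_succ ?_ ?_ hx
    · rintro rfl a
      exact h₂ a [] rfl
    · intro ω hω a
      refine ih (f := f ∘ₗ LinearMap.mulRight ℂ (F.d (F.ι a)))
        (g := g ∘ₗ LinearMap.mulRight ℂ (F.d (F.ι a))) (fun c l hl => ?_) (fun c l hl => ?_) hω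
      · simpa [mulWord_append_singleton] using h₁ c (l ++ [a]) (by simp [hl])
      · simpa [mulWord_append_singleton] using h₂ c (l ++ [a]) (by simp [hl])

variable {F} {b κ : Module.End ℂ F.Ω}

theorem hochschild_hochschild
    (hb_mem : ∀ (m : ℕ) (x : F.Ω), x ∈ F.deg (m + 1) → b x ∈ F.deg m)
    (hb_zero : ∀ x ∈ F.deg 0, b x = 0)
    (hb_d : ∀ a : A, b (F.d (F.ι a)) = 0)
    (hb_form : ∀ (m : ℕ) (ω : F.Ω), ω ∈ F.deg m → ∀ a : A,
      b (ω * F.d (F.ι a)) = ((-1 : ℂ) ^ m) • (ω * F.ι a - F.ι a * ω))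
    {n : ℕ} {x : F.Ω} (hx : x ∈ F.deg n) : b (b x) = 0 := by
  obtain _ | _ | n := n
  · rw [hb_zero x hx, map_zero]
  · exact hb_zero _ (hb_mem 0 x hx)
  refine F.eqOn_deg_succ (f := b * b) (g := 0) (by simp) (fun ω hω a => ?_) hx
  have key : b (ω * F.ι a - F.ι a * ω) = 0 := by
    refine F.eqOn_deg_succ
      (f := b ∘ₗ (LinearMap.mulRight ℂ (F.ι a) - LinearMap.mulLeft ℂ (F.ι a))) (g := 0)
      (fun _ c => ?_) (fun η hη c => ?_) hω
    · simp [F.da_mul, hb_d, hb_form 0 _ (F.ι_mem _)]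
    · have h : η * F.d (F.ι c) * F.ι a
          = η * F.d (F.ι (c * a)) - η * F.ι c * F.d (F.ι a) := by
        rw [mul_assoc, F.da_mul, mul_sub, mul_assoc]
      simp only [LinearMap.comp_apply, LinearMap.sub_apply, LinearMap.mulRight_apply,
        LinearMap.mulLeft_apply, LinearMap.zero_apply, h, map_sub, hb_form n _ hη,
        hb_form n _ (F.mul_ι_mem hη c), ← mul_assoc, hb_form n _ (F.ι_mul_mem hη a), ← smul_sub]
      simp only [F.ι_mul, ← mul_assoc]
      rw [sub_sub_sub_cancel_left, sub_self, smul_zero]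
  simp [hb_form _ _ hω, key]

theorem karoubi_eq
    (hb_zero : ∀ x ∈ F.deg 0, b x = 0)
    (hb_d : ∀ a : A, b (F.d (F.ι a)) = 0)
    (hb_form : ∀ (m : ℕ) (ω : F.Ω), ω ∈ F.deg m → ∀ a : A,
      b (ω * F.d (F.ι a)) = ((-1 : ℂ) ^ m) • (ω * F.ι a - F.ι a * ω))
    (hκ_zero : ∀ x ∈ F.deg 0, κ x = x)
    (hκ_d : ∀ a : A, κ (F.d (F.ι a)) = F.d (F.ι a))
    (hκ_form : ∀ (m : ℕ) (ω : F.Ω), ω ∈ F.deg m → ∀ a : A,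
      κ (ω * F.d (F.ι a)) = ((-1 : ℂ) ^ m) • (F.d (F.ι a) * ω))
    {n : ℕ} {x : F.Ω} (hx : x ∈ F.deg n) : κ x = x - b (F.d x) - F.d (b x) := by
  cases n with
  | zero =>
    rw [hκ_zero x hx, hb_zero x hx]
    rw [F.deg_zero] at hx
    obtain ⟨a, rfl⟩ := hx
    simp [hb_d]
  | succ n =>
    refine F.eqOn_deg_succ (f := κ) (g := 1 - b * F.d - F.d * b) (fun _ a => ?_)
      (fun ω hω a => ?_) hx
    · simp [hκ_d, hb_d, F.d_d]
    · have hs : ((-1 : ℂ) ^ n) * (-1) ^ n = 1 := by rw [← mul_pow]; simp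
      simp only [LinearMap.sub_apply, Module.End.mul_apply, Module.End.one_apply,
        F.d_mul_d_ι hω, hb_form _ _ (F.d_mem hω), hb_form _ _ hω, hκ_form _ _ hω, map_smul,
        map_sub, F.leibniz hω, F.leibniz (F.ι_mem a), smul_sub, smul_add, smul_smul, hs, pow_succ,
        pow_zero, one_smul, mul_neg, mul_one, neg_smul]
      abel

theorem karoubi_pow_mulWord
    (hκ_form : ∀ (m : ℕ) (ω : F.Ω), ω ∈ F.deg m → ∀ a : A,
      κ (ω * F.d (F.ι a)) = ((-1 : ℂ) ^ m) • (F.d (F.ι a) * ω))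
    (l : List A) {m : ℕ} {ω : F.Ω} (hω : ω ∈ F.deg m) :
    (κ ^ l.length) (F.mulWord ω l)
      = ((-1 : ℂ) ^ (l.length * (m + l.length + 1))) • F.wordMul l ω := by
  induction l using List.reverseRecOn generalizing m ω with
  | nil => simp [mulWord, wordMul]
  | append_singleton l a ih =>
    rw [mulWord_append_singleton, wordMul_append_singleton, List.length_append,
      List.length_singleton, pow_succ, Module.End.mul_apply, hκ_form _ _ (F.mulWord_mem hω l),
      mul_mulWord, map_smul, ih (F.d_ι_mul_mem hω a), smul_smul, ← pow_add]
    congr 1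
    rw [show (l.length + 1) * (m + (l.length + 1) + 1)
      = m + l.length + l.length * (m + 1 + l.length + 1) + 2 by ring, pow_add _ _ 2]
    simp

theorem karoubi_pow_mulWord_ι
    (hκ_form : ∀ (m : ℕ) (ω : F.Ω), ω ∈ F.deg m → ∀ a : A,
      κ (ω * F.d (F.ι a)) = ((-1 : ℂ) ^ m) • (F.d (F.ι a) * ω))
    (l : List A) (a : A) :
    (κ ^ l.length) (F.mulWord (F.ι a) l) = F.wordMul l (F.ι a) := by
  rw [karoubi_pow_mulWord hκ_form l (F.ι_mem a), zero_add,
    (Nat.even_mul_succ_self l.length).neg_one_pow, one_smul]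

theorem karoubi_pow_mulWord_d
    (hκ_form : ∀ (m : ℕ) (ω : F.Ω), ω ∈ F.deg m → ∀ a : A,
      κ (ω * F.d (F.ι a)) = ((-1 : ℂ) ^ m) • (F.d (F.ι a) * ω))
    (l : List A) (a : A) :
    (κ ^ l.length) (F.mulWord (F.d (F.ι a)) l)
      = ((-1 : ℂ) ^ l.length) • F.wordMul l (F.d (F.ι a)) := by
  rw [karoubi_pow_mulWord hκ_form l (F.d_ι_mem a),
    show l.length * (1 + l.length + 1) = l.length * (l.length + 1) + l.length by ring, pow_add,
    (Nat.even_mul_succ_self l.length).neg_one_pow, one_mul]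

/-- Cyclic invariance: `κ^{n+1}` fixes `d a₀ d a₁ ⋯ d aₙ`. -/
theorem karoubi_pow_succ_mulWord_d
    (hκ_d : ∀ a : A, κ (F.d (F.ι a)) = F.d (F.ι a))
    (hκ_form : ∀ (m : ℕ) (ω : F.Ω), ω ∈ F.deg m → ∀ a : A,
      κ (ω * F.d (F.ι a)) = ((-1 : ℂ) ^ m) • (F.d (F.ι a) * ω))
    (l : List A) (a : A) :
    (κ ^ (l.length + 1)) (F.mulWord (F.d (F.ι a)) l) = F.mulWord (F.d (F.ι a)) l := by
  rw [pow_succ', Module.End.mul_apply, karoubi_pow_mulWord_d hκ_form, map_smul]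
  cases l with
  | nil => simpa [wordMul, mulWord] using hκ_d a
  | cons c t =>
    rw [← mulWord_mul_eq_wordMul, hκ_form _ _ (F.mulWord_mem (F.d_ι_mem c) t), mul_mulWord,
      smul_smul, add_comm 1, List.length_cons, ← mul_pow]
    simp [mulWord]

theorem karoubi_pow_succ_d
    (hκ_d : ∀ a : A, κ (F.d (F.ι a)) = F.d (F.ι a))
    (hκ_form : ∀ (m : ℕ) (ω : F.Ω), ω ∈ F.deg m → ∀ a : A,
      κ (ω * F.d (F.ι a)) = ((-1 : ℂ) ^ m) • (F.d (F.ι a) * ω))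
    {n : ℕ} {x : F.Ω} (hx : x ∈ F.deg n) : (κ ^ (n + 1)) (F.d x) = F.d x := by
  refine F.eqOn_deg_of_mulWord (f := κ ^ (n + 1) * F.d) (g := F.d) (fun a l hl => ?_)
    (fun a l hl => ?_) hx
  · rw [Module.End.mul_apply, F.d_mulWord (F.ι_mem a), ← hl,
      karoubi_pow_succ_mulWord_d hκ_d hκ_form]
  · have h : F.d (F.mulWord (F.d (F.ι a)) l) = 0 := by
      rw [← F.d_mulWord (F.ι_mem a), F.d_d]
    rw [Module.End.mul_apply, h, map_zero]

theorem karoubi_pow_eq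
    (hb_d : ∀ a : A, b (F.d (F.ι a)) = 0)
    (hb_form : ∀ (m : ℕ) (ω : F.Ω), ω ∈ F.deg m → ∀ a : A,
      b (ω * F.d (F.ι a)) = ((-1 : ℂ) ^ m) • (ω * F.ι a - F.ι a * ω))
    (hκ_d : ∀ a : A, κ (F.d (F.ι a)) = F.d (F.ι a))
    (hκ_form : ∀ (m : ℕ) (ω : F.Ω), ω ∈ F.deg m → ∀ a : A,
      κ (ω * F.d (F.ι a)) = ((-1 : ℂ) ^ m) • (F.d (F.ι a) * ω))
    {n : ℕ} {x : F.Ω} (hx : x ∈ F.deg n) : (κ ^ n) x = x + b ((κ ^ n) (F.d x)) := by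
  refine F.eqOn_deg_of_mulWord (f := κ ^ n) (g := 1 + b * κ ^ n * F.d) (fun a l hl => ?_)
    (fun a l hl => ?_) hx
  · subst hl
    rw [LinearMap.add_apply, Module.End.mul_apply, Module.End.mul_apply, Module.End.one_apply,
      F.d_mulWord (F.ι_mem a), karoubi_pow_mulWord_d hκ_form, karoubi_pow_mulWord_ι hκ_form,
      map_smul]
    cases l with
    | nil => simp [wordMul, mulWord, hb_d]
    | cons c t =>
      rw [← mulWord_mul_eq_wordMul, ← mulWord_mul_eq_wordMul,
        hb_form _ _ (F.mulWord_mem (F.d_ι_mem c) t), smul_smul, add_comm 1, List.length_cons,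
        ← mul_pow, mul_mulWord]
      simp [mulWord]
  · have h : F.d (F.mulWord (F.d (F.ι a)) l) = 0 := by
      rw [← F.d_mulWord (F.ι_mem a), F.d_d]
    rw [LinearMap.add_apply, Module.End.mul_apply, h, map_zero, add_zero, Module.End.one_apply,
      ← hl, karoubi_pow_succ_mulWord_d hκ_d hκ_form]

end

end Forms

/-- Identities for the Karoubi operator on `Ωⁿ A`:
(1) `κⁿ = id + b ∘ κⁿ ∘ d`; (2) `κ^{n+1} (dω) = dω`; (3) `κ^{n+1} = id − d ∘ b`;
(4) `κⁿ (bω) = bω` for `ω ∈ Ωⁿ A`, `n ≥ 1`; (5) `(κⁿ − id)(κ^{n+1} − id) = 0` on `Ωⁿ A`.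
In particular `κ` satisfies a polynomial identity on each `Ωⁿ A`. -/
theorem karoubi_polynomial_identities
    {A : Type} [NonUnitalRing A] [Module ℂ A] [SMulCommClass ℂ A A] [IsScalarTower ℂ A A]
    (F : Forms A) (b κ : Module.End ℂ F.Ω)
    (hb_mem : ∀ (m : ℕ) (x : F.Ω), x ∈ F.deg (m + 1) → b x ∈ F.deg m)
    (hb_zero : ∀ x ∈ F.deg 0, b x = 0)
    (hb_d : ∀ a : A, b (F.d (F.ι a)) = 0)
    (hb_form : ∀ (m : ℕ) (ω : F.Ω), ω ∈ F.deg m → ∀ a : A,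
      b (ω * F.d (F.ι a)) = ((-1 : ℂ) ^ m) • (ω * F.ι a - F.ι a * ω))
    (hκ_mem : ∀ (m : ℕ) (x : F.Ω), x ∈ F.deg m → κ x ∈ F.deg m)
    (hκ_zero : ∀ x ∈ F.deg 0, κ x = x)
    (hκ_d : ∀ a : A, κ (F.d (F.ι a)) = F.d (F.ι a))
    (hκ_form : ∀ (m : ℕ) (ω : F.Ω), ω ∈ F.deg m → ∀ a : A,
      κ (ω * F.d (F.ι a)) = ((-1 : ℂ) ^ m) • (F.d (F.ι a) * ω)) :
    (∀ (n : ℕ), ∀ x ∈ F.deg n, (κ ^ n) x = x + b ((κ ^ n) (F.d x))) ∧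
    (∀ (n : ℕ), ∀ x ∈ F.deg n, (κ ^ (n + 1)) (F.d x) = F.d x) ∧
    (∀ (n : ℕ), ∀ x ∈ F.deg n, (κ ^ (n + 1)) x = x - F.d (b x)) ∧
    (∀ (n : ℕ), 1 ≤ n → ∀ x ∈ F.deg n, (κ ^ n) (b x) = b x) ∧
    (∀ (n : ℕ), ∀ x ∈ F.deg n, ((κ ^ n - 1) * (κ ^ (n + 1) - 1)) x = 0) := by
  have hbb {n : ℕ} {x : F.Ω} (hx : x ∈ F.deg n) : b (b x) = 0 :=
    Forms.hochschild_hochschild hb_mem hb_zero hb_d hb_form hx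
  have hκ {n : ℕ} {x : F.Ω} (hx : x ∈ F.deg n) : κ x = x - b (F.d x) - F.d (b x) :=
    Forms.karoubi_eq hb_zero hb_d hb_form hκ_zero hκ_d hκ_form hx
  have hpow_mem (k n : ℕ) (x : F.Ω) (hx : x ∈ F.deg n) : (κ ^ k) x ∈ F.deg n := by
    induction k with
    | zero => exact hx
    | succ k ih => rw [pow_succ', Module.End.mul_apply]; exact hκ_mem n _ ih
  have hκb (n : ℕ) (x : F.Ω) (hx : x ∈ F.deg (n + 1)) : κ (b x) = b (κ x) := by
    rw [hκ (hb_mem n x hx), hκ hx, hbb hx, map_sub, map_sub, hbb (F.d_mem hx)]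
    simp
  have hκd (n : ℕ) (x : F.Ω) (hx : x ∈ F.deg n) : κ (F.d x) = F.d (κ x) := by
    rw [hκ (F.d_mem hx), hκ hx, map_sub, map_sub, F.d_d, F.d_d]
    simp
  have hpow_d (k n : ℕ) (x : F.Ω) (hx : x ∈ F.deg n) : (κ ^ k) (F.d x) = F.d ((κ ^ k) x) := by
    induction k with
    | zero => rfl
    | succ k ih =>
      rw [pow_succ', Module.End.mul_apply, ih, hκd n _ (hpow_mem k n x hx), Module.End.mul_apply]
  have h₁ (n : ℕ) (x : F.Ω) (hx : x ∈ F.deg n) : (κ ^ n) x = x + b ((κ ^ n) (F.d x)) :=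
    Forms.karoubi_pow_eq hb_d hb_form hκ_d hκ_form hx
  have h₂ (n : ℕ) (x : F.Ω) (hx : x ∈ F.deg n) : (κ ^ (n + 1)) (F.d x) = F.d x :=
    Forms.karoubi_pow_succ_d hκ_d hκ_form hx
  have h₃ (n : ℕ) (x : F.Ω) (hx : x ∈ F.deg n) : (κ ^ (n + 1)) x = x - F.d (b x) := by
    rw [pow_succ', Module.End.mul_apply, h₁ n x hx, map_add,
      hκb n _ (hpow_mem n _ _ (F.d_mem hx)), ← Module.End.mul_apply κ, ← pow_succ', h₂ n x hx,
      hκ hx]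
    abel
  have h₄ (n : ℕ) (hn : 1 ≤ n) (x : F.Ω) (hx : x ∈ F.deg n) : (κ ^ n) (b x) = b x := by
    obtain ⟨n, rfl⟩ := Nat.exists_eq_add_of_le' hn
    rw [h₃ n _ (hb_mem n x hx), hbb hx, map_zero, sub_zero]
  refine ⟨h₁, h₂, h₃, h₄, fun n x hx => ?_⟩
  cases n with
  | zero => simp
  | succ n =>
    have hbx := hb_mem n x hx
    simp only [Module.End.mul_apply, LinearMap.sub_apply, Module.End.one_apply,
      h₃ (n + 1) x hx, map_sub, hpow_d _ n _ hbx, h₄ (n + 1) n.succ_pos x hx]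
    abel
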